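/- Let n ≥ 3, let α, β, γ, ν be real numbers and let 1 < p < ∞. Then the operator S = S_{α,β,γ} is bounded from L^p_ν(Λ_n) into L^∞(Λ_n) if and only if the parameters satisfy all three of: (i) γ = α + β + n/2 − ν/p; (ii) ν < p(β + 1) + n/2 − 1; (iii) p(α − n/2 + 1) > −n/2 + 1. (This is the paper's Theorem 2.3 instantiated on the rank-2 Lorentz cone, where n/r = n/2.) -/

import Mathlib

open MeasureTheory ENNReal

noncomputable section

/-- The Lorentz determinant `Δ(y) = y₁² − y₂² − ⋯ − y_n²`. -/
def lDelta (n : ℕ) [NeZero n] (y : Fin n → ℝ) : ℝ :=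
  2 * y 0 ^ 2 - ∑ i, y i ^ 2

/-- The Lorentz cone `Λ_n`. -/
def lCone (n : ℕ) [NeZero n] : Set (Fin n → ℝ) :=
  {y | 0 < lDelta n y ∧ 0 < y 0}

/-- The `L^p_ν(Λ_n)` norm `(∫_{Λ_n} |g(y)|^p Δ(y)^{ν−n/2} dy)^{1/p}`. -/
def coneNorm (n : ℕ) [NeZero n] (p ν : ℝ) (g : (Fin n → ℝ) → ℝ) : ℝ≥0∞ :=
  (∫⁻ y in lCone n, ENNReal.ofReal (|g y| ^ p * lDelta n y ^ (ν - (n : ℝ) / 2))) ^ (1 / p)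

/-- The operator `S_{α,β,γ}` applied to `|g|`:
`S|g|(y) = Δ(y)^α ∫_{Λ_n} Δ(y+x)^{−γ} |g(x)| Δ(x)^β dx`. -/
def Sop (n : ℕ) [NeZero n] (α β γ : ℝ) (g : (Fin n → ℝ) → ℝ) (y : Fin n → ℝ) : ℝ≥0∞ :=
  ENNReal.ofReal (lDelta n y ^ α) *
    ∫⁻ x in lCone n, ENNReal.ofReal (lDelta n (y + x) ^ (-γ) * |g x| * lDelta n x ^ β)

/-- The `L^q_μ(Λ_n)` norm of `S_{α,β,γ}|g|`. -/
def SopNorm (n : ℕ) [NeZero n] (α β γ q μ : ℝ) (g : (Fin n → ℝ) → ℝ) : ℝ≥0∞ :=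
  (∫⁻ y in lCone n, Sop n α β γ g y ^ q * ENNReal.ofReal (lDelta n y ^ (μ - (n : ℝ) / 2))) ^ (1 / q)

/-- `S_{α,β,γ}` is bounded from `L^p_ν(Λ_n)` to `L^q_μ(Λ_n)`:
`‖S|g|‖_{q,μ} ≤ C ‖g‖_{p,ν}` for every `g ∈ L^p_ν(Λ_n)`. -/
def SBounded (n : ℕ) [NeZero n] (α β γ p ν q μ : ℝ) : Prop :=
  ∃ C > (0 : ℝ), ∀ g : (Fin n → ℝ) → ℝ, Measurable g → coneNorm n p ν g < ⊤ →
    SopNorm n α β γ q μ g ≤ ENNReal.ofReal C * coneNorm n p ν g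

/-- `S_{α,β,γ}` is bounded from `L^p_ν(Λ_n)` to `L^∞(Λ_n)`:
`sup_{y∈Λ_n} S|g|(y) ≤ C ‖g‖_{p,ν}` for every `g ∈ L^p_ν(Λ_n)`. -/
def SBoundedSup (n : ℕ) [NeZero n] (α β γ p ν : ℝ) : Prop :=
  ∃ C > (0 : ℝ), ∀ g : (Fin n → ℝ) → ℝ, Measurable g → coneNorm n p ν g < ⊤ →
    ∀ y ∈ lCone n, Sop n α β γ g y ≤ ENNReal.ofReal C * coneNorm n p ν g

/-- The matrix `J = diag(1, −1, …, −1)` of the Lorentz form. -/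
def lorentzMatrix (n : ℕ) [NeZero n] : Matrix (Fin n) (Fin n) ℝ :=
  Matrix.diagonal fun i => if i = 0 then 1 else -1

/-- The quadratic representation `P(z) = 2 z zᵀ − Δ(z) J` of the Lorentz cone. -/
def quadRep (n : ℕ) [NeZero n] (z : Fin n → ℝ) : Matrix (Fin n) (Fin n) ℝ :=
  (2 : ℝ) • Matrix.vecMulVec z z - lDelta n z • lorentzMatrix n

/-- The identity element `(1, 0, …, 0)` of the Lorentz cone. -/
def coneUnit (n : ℕ) [NeZero n] : Fin n → ℝ := Pi.single 0 1

section Symmetry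

variable {n : ℕ} [NeZero n]

lemma lorentzMatrix_mulVec_apply (y : Fin n → ℝ) (i : Fin n) :
    (lorentzMatrix n).mulVec y i = if i = 0 then y i else - y i := by
  rw [lorentzMatrix, Matrix.mulVec_diagonal]
  split_ifs <;> ring

lemma lorentzMatrix_mul_self : lorentzMatrix n * lorentzMatrix n = 1 := by
  rw [lorentzMatrix, Matrix.diagonal_mul_diagonal, ← Matrix.diagonal_one]
  congr 1
  ext i
  split_ifs <;> norm_num

lemma dotProduct_lorentzMatrix_mulVec (y : Fin n → ℝ) :
    y ⬝ᵥ (lorentzMatrix n).mulVec y = lDelta n y := by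
  have h : ∀ i, y i * (lorentzMatrix n).mulVec y i
      = (if i = 0 then 2 * y 0 ^ 2 else 0) - y i ^ 2 := by
    intro i
    rw [lorentzMatrix_mulVec_apply]
    split_ifs with hi
    · subst hi; ring
    · ring
  rw [dotProduct, Finset.sum_congr rfl fun i _ => h i, Finset.sum_sub_distrib, lDelta]
  simp

lemma quadRep_transpose (z : Fin n → ℝ) : (quadRep n z).transpose = quadRep n z := by
  simp [quadRep, lorentzMatrix, Matrix.transpose_vecMulVec]

lemma quadRep_mul_lorentzMatrix_mul (z : Fin n → ℝ) :
    quadRep n z * lorentzMatrix n * quadRep n z = lDelta n z ^ 2 • lorentzMatrix n := by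
  have h1 : Matrix.vecMulVec z z * lorentzMatrix n * Matrix.vecMulVec z z
      = lDelta n z • Matrix.vecMulVec z z := by
    rw [Matrix.mul_assoc, Matrix.mul_vecMulVec, Matrix.vecMulVec_mul_vecMulVec,
      dotProduct_lorentzMatrix_mulVec, Matrix.vecMulVec_smul]
  have h2 : Matrix.vecMulVec z z * lorentzMatrix n * lorentzMatrix n = Matrix.vecMulVec z z := by
    rw [Matrix.mul_assoc, lorentzMatrix_mul_self, Matrix.mul_one]
  simp only [quadRep, Matrix.sub_mul, Matrix.mul_sub, Matrix.smul_mul, Matrix.mul_smul, h1, h2,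
    lorentzMatrix_mul_self, Matrix.one_mul]
  module

lemma lDelta_quadRep_mulVec (z x : Fin n → ℝ) :
    lDelta n ((quadRep n z).mulVec x) = lDelta n z ^ 2 * lDelta n x := by
  rw [← dotProduct_lorentzMatrix_mulVec ((quadRep n z).mulVec x), Matrix.mulVec_mulVec,
    Matrix.dotProduct_mulVec, ← Matrix.mulVec_transpose, Matrix.mulVec_mulVec,
    Matrix.transpose_mul, quadRep_transpose]
  have hJ : (lorentzMatrix n).transpose = lorentzMatrix n := by simp [lorentzMatrix]
  rw [hJ, quadRep_mul_lorentzMatrix_mul, Matrix.smul_mulVec, smul_dotProduct, dotProduct_comm,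
    dotProduct_lorentzMatrix_mulVec, smul_eq_mul]

lemma abs_det_quadRep (z : Fin n → ℝ) : |(quadRep n z).det| = |lDelta n z| ^ n := by
  have h := congrArg Matrix.det (quadRep_mul_lorentzMatrix_mul z)
  have hJ : (lorentzMatrix n).det ≠ 0 := by
    intro h0
    have := congrArg Matrix.det (lorentzMatrix_mul_self (n := n))
    rw [Matrix.det_mul, h0, Matrix.det_one] at this
    norm_num at this
  rw [Matrix.det_mul, Matrix.det_mul, Matrix.det_smul, Fintype.card_fin] at h
  have h2 : (quadRep n z).det ^ 2 = (lDelta n z ^ n) ^ 2 := by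
    apply mul_right_cancel₀ hJ
    rw [← pow_mul, mul_comm n 2, pow_mul, ← h]
    ring
  rw [← abs_pow]
  exact (sq_eq_sq_iff_abs_eq_abs _ _).1 h2

lemma quadRep_mulVec_apply (z x : Fin n → ℝ) (i : Fin n) :
    (quadRep n z).mulVec x i
      = 2 * z i * (z ⬝ᵥ x) - lDelta n z * (if i = 0 then x i else - x i) := by
  rw [quadRep, Matrix.sub_mulVec, Matrix.smul_mulVec, Matrix.smul_mulVec, Pi.sub_apply,
    Pi.smul_apply, Pi.smul_apply, lorentzMatrix_mulVec_apply, Matrix.vecMulVec_mulVec]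
  simp [mul_comm, mul_assoc, mul_left_comm]

lemma lDelta_eq_sub_sum_erase (y : Fin n → ℝ) :
    lDelta n y = y 0 ^ 2 - ∑ i ∈ Finset.univ.erase 0, y i ^ 2 := by
  rw [lDelta, ← Finset.add_sum_erase Finset.univ (fun i => y i ^ 2) (Finset.mem_univ 0)]
  ring

lemma sq_sum_erase_lt {x y : Fin n → ℝ} (hx : x ∈ lCone n) (hy : y ∈ lCone n) :
    (∑ i ∈ Finset.univ.erase 0, x i * y i) ^ 2 < (x 0 * y 0) ^ 2 := by
  have h := Finset.sum_mul_sq_le_sq_mul_sq (Finset.univ.erase (0 : Fin n)) x y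
  obtain ⟨hx1, hx0⟩ := hx
  obtain ⟨hy1, hy0⟩ := hy
  rw [lDelta_eq_sub_sum_erase] at hx1 hy1
  have hA : 0 ≤ ∑ i ∈ Finset.univ.erase (0 : Fin n), x i ^ 2 :=
    Finset.sum_nonneg fun i _ => sq_nonneg _
  have hB : 0 ≤ ∑ i ∈ Finset.univ.erase (0 : Fin n), y i ^ 2 :=
    Finset.sum_nonneg fun i _ => sq_nonneg _
  refine h.trans_lt ?_
  rw [mul_pow]
  have hy2 : 0 < y 0 ^ 2 := by positivity
  nlinarith

lemma abs_sum_erase_lt {x y : Fin n → ℝ} (hx : x ∈ lCone n) (hy : y ∈ lCone n) :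
    |∑ i ∈ Finset.univ.erase 0, x i * y i| < x 0 * y 0 := by
  have h := sq_lt_sq.1 (sq_sum_erase_lt hx hy)
  rwa [abs_of_pos (mul_pos hx.2 hy.2)] at h

lemma add_mem_lCone {x y : Fin n → ℝ} (hx : x ∈ lCone n) (hy : y ∈ lCone n) :
    x + y ∈ lCone n := by
  have h := (abs_lt.1 (abs_sum_erase_lt hx hy)).2
  have hx1 := hx.1
  have hy1 := hy.1
  refine ⟨?_, add_pos hx.2 hy.2⟩
  rw [lDelta_eq_sub_sum_erase] at hx1 hy1 ⊢
  simp only [Pi.add_apply, add_sq, Finset.sum_add_distrib, mul_assoc, ← Finset.mul_sum]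
  linarith

lemma quadRep_mulVec_mem {z x : Fin n → ℝ} (hz : z ∈ lCone n) (hx : x ∈ lCone n) :
    (quadRep n z).mulVec x ∈ lCone n := by
  refine ⟨?_, ?_⟩
  · rw [lDelta_quadRep_mulVec]
    exact mul_pos (pow_pos hz.1 2) hx.1
  · have h := (abs_lt.1 (abs_sum_erase_lt hz hx)).1
    have hz1 := hz.1
    have hx1 := hx.1
    have hz0 := hz.2
    have hx0 := hx.2
    have hP := Finset.sum_mul_sq_le_sq_mul_sq (Finset.univ.erase (0 : Fin n)) z x
    rw [quadRep_mulVec_apply, dotProduct, if_pos rfl,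
      ← Finset.add_sum_erase Finset.univ (fun i => z i * x i) (Finset.mem_univ 0)]
    rw [lDelta_eq_sub_sum_erase] at hz1 hx1 ⊢
    have hA : 0 ≤ ∑ i ∈ Finset.univ.erase (0 : Fin n), z i ^ 2 :=
      Finset.sum_nonneg fun i _ => sq_nonneg _
    set A := ∑ i ∈ Finset.univ.erase (0 : Fin n), z i ^ 2
    set B := ∑ i ∈ Finset.univ.erase (0 : Fin n), x i ^ 2
    set P := ∑ i ∈ Finset.univ.erase (0 : Fin n), z i * x i
    have h1 : (2 * z 0 * P) ^ 2 < ((z 0 ^ 2 + A) * x 0) ^ 2 := by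
      have h2 : P ^ 2 ≤ A * x 0 ^ 2 := hP.trans (by nlinarith)
      have h3 : 0 < ((z 0 ^ 2 - A) * x 0) ^ 2 := by positivity
      have h4 : 4 * z 0 ^ 2 * P ^ 2 ≤ 4 * z 0 ^ 2 * (A * x 0 ^ 2) := by gcongr
      nlinarith
    have h5 := (abs_lt.1 (abs_lt_of_sq_lt_sq h1 (by positivity))).1
    linarith

lemma quadRep_mulVec_mem_iff {z x : Fin n → ℝ} (hz : z ∈ lCone n) :
    (quadRep n z).mulVec x ∈ lCone n ↔ x ∈ lCone n := by
  refine ⟨fun h => ?_, quadRep_mulVec_mem hz⟩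
  have h1 := h.1
  rw [lDelta_quadRep_mulVec] at h1
  have hx1 : 0 < lDelta n x := pos_of_mul_pos_right h1 (sq_nonneg _)
  refine ⟨hx1, ?_⟩
  by_contra! hx0
  have hne : x 0 ≠ 0 := by
    intro h0
    rw [lDelta_eq_sub_sum_erase, h0] at hx1
    have : 0 ≤ ∑ i ∈ Finset.univ.erase (0 : Fin n), x i ^ 2 :=
      Finset.sum_nonneg fun i _ => sq_nonneg _
    linarith
  have hneg : -x ∈ lCone n := by
    refine ⟨by simpa [lDelta] using hx1, ?_⟩
    simpa using lt_of_le_of_ne hx0 hne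
  have h2 := (quadRep_mulVec_mem hz hneg).2
  rw [Matrix.mulVec_neg, Pi.neg_apply] at h2
  linarith [h.2]

lemma lDelta_coneUnit : lDelta n (coneUnit n) = 1 := by
  rw [lDelta_eq_sub_sum_erase, Finset.sum_eq_zero]
  · simp [coneUnit]
  · intro i hi
    simp [coneUnit, Finset.ne_of_mem_erase hi]

lemma coneUnit_mem : coneUnit n ∈ lCone n :=
  ⟨by rw [lDelta_coneUnit]; exact one_pos, by simp [coneUnit]⟩

lemma exists_quadRep_mulVec_coneUnit {y : Fin n → ℝ} (hy : y ∈ lCone n) :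
    ∃ z ∈ lCone n, (quadRep n z).mulVec (coneUnit n) = y := by
  obtain ⟨hy1, hy0⟩ := hy
  set d := √(lDelta n y) with hd
  have hdpos : 0 < d := Real.sqrt_pos.2 hy1
  have hd2 : d ^ 2 = lDelta n y := Real.sq_sqrt hy1.le
  set s := √((y 0 + d) / 2) with hs
  have hspos : 0 < s := Real.sqrt_pos.2 (by positivity)
  have hs2 : s ^ 2 = (y 0 + d) / 2 := Real.sq_sqrt (by positivity)
  set z : Fin n → ℝ := fun i => if i = 0 then s else y i / (2 * s) with hz
  have hz0 : z 0 = s := by simp [hz]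
  have hzi : ∀ i, i ≠ 0 → z i = y i / (2 * s) := fun i hi => by simp [hz, hi]
  have hsum : ∑ i ∈ Finset.univ.erase (0 : Fin n), z i ^ 2
      = (y 0 ^ 2 - d ^ 2) / (4 * s ^ 2) := by
    rw [hd2, lDelta_eq_sub_sum_erase, sub_sub_self, Finset.sum_div]
    refine Finset.sum_congr rfl fun i hi => ?_
    rw [hzi i (Finset.ne_of_mem_erase hi)]
    ring
  have hzd : lDelta n z = d := by
    rw [lDelta_eq_sub_sum_erase, hsum, hz0, hs2]
    field_simp
    ring
  refine ⟨z, ⟨hzd ▸ hdpos, hz0 ▸ hspos⟩, ?_⟩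
  ext i
  rw [quadRep_mulVec_apply, hzd]
  have hdot : z ⬝ᵥ coneUnit n = s := by simp [coneUnit, hz0]
  rw [hdot]
  split_ifs with hi
  · subst hi
    rw [hz0, mul_assoc, ← sq, hs2]
    simp only [coneUnit, Pi.single_eq_same]
    ring
  · rw [hzi i hi]
    simp only [coneUnit, Pi.single_apply, hi, if_false]
    field_simp
    ring

lemma continuous_lDelta : Continuous (lDelta n) := by
  unfold lDelta
  fun_prop

lemma measurable_lDelta : Measurable (lDelta n) := continuous_lDelta.measurable

lemma isOpen_lCone : IsOpen (lCone n) :=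
  (isOpen_lt continuous_const continuous_lDelta).inter
    (isOpen_lt continuous_const (continuous_apply 0))

lemma measurableSet_lCone : MeasurableSet (lCone n) := isOpen_lCone.measurableSet

end Symmetry

/-- The generalized beta integral `∫_{Λ_n} Δ(y+x)^{−a} Δ(x)^c dx`. -/
def coneBeta (n : ℕ) [NeZero n] (a c : ℝ) (y : Fin n → ℝ) : ℝ≥0∞ :=
  ∫⁻ x in lCone n, ENNReal.ofReal (lDelta n (y + x) ^ (-a) * lDelta n x ^ c)

lemma measurable_coneBeta_integrand {n : ℕ} [NeZero n] (a c : ℝ) (y : Fin n → ℝ) :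
    Measurable fun x => lDelta n (y + x) ^ (-a) * lDelta n x ^ c :=
  ((measurable_lDelta.comp (measurable_const_add y)).pow_const _).mul
    (measurable_lDelta.pow_const _)

lemma coneBeta_eq {n : ℕ} [NeZero n] (a c : ℝ) {y : Fin n → ℝ} (hy : y ∈ lCone n) :
    coneBeta n a c y
      = ENNReal.ofReal (lDelta n y ^ ((n : ℝ) / 2 - a + c)) * coneBeta n a c (coneUnit n) := by
  obtain ⟨z, hz, rfl⟩ := exists_quadRep_mulVec_coneUnit hy
  have hz1 := hz.1
  have hdet : |(quadRep n z).det| = lDelta n z ^ n := by rw [abs_det_quadRep, abs_of_pos hz1]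
  have hdet0 : (quadRep n z).det ≠ 0 := by
    rw [← abs_pos, hdet]
    positivity
  have hmap := Real.map_matrix_volume_pi_eq_smul_volume_pi hdet0
  have hvol : (volume : Measure (Fin n → ℝ)) = ENNReal.ofReal (lDelta n z ^ n) •
      Measure.map (Matrix.toLin' (quadRep n z)) volume := by
    rw [hmap, smul_smul, ← ENNReal.ofReal_mul (by positivity), abs_inv, hdet,
      mul_inv_cancel₀ (by positivity), ENNReal.ofReal_one, one_smul]
  have hmeas : Measurable (Matrix.toLin' (quadRep n z)) :=
    (LinearMap.continuous_of_finiteDimensional _).measurable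
  have hpre : (Matrix.toLin' (quadRep n z)) ⁻¹' (lCone n) = lCone n := by
    ext x
    simp only [Set.mem_preimage, Matrix.toLin'_apply]
    exact quadRep_mulVec_mem_iff hz
  conv_lhs => rw [coneBeta, hvol]
  rw [Measure.restrict_smul, lintegral_smul_measure,
    setLIntegral_map measurableSet_lCone (measurable_coneBeta_integrand _ _ _).ennreal_ofReal hmeas,
    hpre, lDelta_quadRep_mulVec, lDelta_coneUnit, smul_eq_mul, coneBeta]
  have hpt : ∀ x ∈ lCone n, ENNReal.ofReal
      (lDelta n ((quadRep n z).mulVec (coneUnit n) + Matrix.toLin' (quadRep n z) x) ^ (-a)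
        * lDelta n (Matrix.toLin' (quadRep n z) x) ^ c)
      = ENNReal.ofReal (lDelta n z ^ (-2 * a + 2 * c)) *
        ENNReal.ofReal (lDelta n (coneUnit n + x) ^ (-a) * lDelta n x ^ c) := by
    intro x hx
    rw [← ENNReal.ofReal_mul (by positivity), Matrix.toLin'_apply, ← Matrix.mulVec_add,
      lDelta_quadRep_mulVec, lDelta_quadRep_mulVec, Real.mul_rpow (by positivity)
      (add_mem_lCone coneUnit_mem hx).1.le, Real.mul_rpow (by positivity) hx.1.le,
      Real.rpow_add hz1, ← Real.rpow_natCast, ← Real.rpow_mul hz1.le, ← Real.rpow_mul hz1.le]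
    congr 1
    push_cast
    rw [show (-2 : ℝ) * a = 2 * -a by ring]
    ring
  rw [setLIntegral_congr_fun measurableSet_lCone hpt, lintegral_const_mul _
    (measurable_coneBeta_integrand _ _ _).ennreal_ofReal, ← mul_assoc,
    ← ENNReal.ofReal_mul (by positivity)]
  congr 2
  rw [mul_one, ← Real.rpow_natCast, ← Real.rpow_natCast, ← Real.rpow_add hz1,
    ← Real.rpow_mul hz1.le]
  congr 1
  push_cast
  ring

lemma lintegral_fun_norm_addHaar {E : Type*} [NormedAddCommGroup E] [NormedSpace ℝ E]
    [MeasurableSpace E] [Nontrivial E] (μ : Measure E) [FiniteDimensional ℝ E] [BorelSpace E]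
    [μ.IsAddHaarMeasure] {f : ℝ → ℝ≥0∞} (hf : Measurable f) :
    ∫⁻ x, f ‖x‖ ∂μ = μ.toSphere Set.univ *
      ∫⁻ r in Set.Ioi (0 : ℝ), ENNReal.ofReal (r ^ (Module.finrank ℝ E - 1)) * f r :=
  calc
    ∫⁻ x, f ‖x‖ ∂μ = ∫⁻ x : ({(0)}ᶜ : Set E), f ‖x.1‖ ∂(μ.comap (↑)) := by
      rw [lintegral_subtype_comap (measurableSet_singleton _).compl fun x ↦ f ‖x‖,
        restrict_compl_singleton]
    _ = ∫⁻ x, f x.2 ∂μ.toSphere.prod (.volumeIoiPow (Module.finrank ℝ E - 1)) := by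
      simpa using μ.measurePreserving_homeomorphUnitSphereProd.lintegral_comp
        (f := f ∘ Subtype.val ∘ Prod.snd) (hf.comp (measurable_subtype_coe.comp measurable_snd))
    _ = μ.toSphere Set.univ *
        ∫⁻ x : Set.Ioi (0 : ℝ), f x ∂.volumeIoiPow (Module.finrank ℝ E - 1) := by
      have hm : Measurable fun x : Metric.sphere (0 : E) 1 × Set.Ioi (0 : ℝ) => f x.2 :=
        hf.comp (measurable_subtype_coe.comp measurable_snd)
      rw [lintegral_prod _ hm.aemeasurable]
      simp [mul_comm]
    _ = _ := by
      have hm : Measurable fun x : Set.Ioi (0 : ℝ) => f x := hf.comp measurable_subtype_coe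
      rw [Measure.volumeIoiPow, lintegral_withDensity_eq_lintegral_mul _
        (measurable_subtype_coe.pow_const _).ennreal_ofReal hm]
      simp only [Pi.mul_apply]
      rw [lintegral_subtype_comap measurableSet_Ioi
        fun r ↦ ENNReal.ofReal (r ^ (Module.finrank ℝ E - 1)) * f r]

/-- The density `s^c (1+s)^{−a}` on the positive half-line. -/
def betaKernel (a c s : ℝ) : ℝ≥0∞ :=
  (Set.Ioi (0 : ℝ)).indicator (fun s => ENNReal.ofReal (s ^ c * (1 + s) ^ (-a))) s

lemma betaKernel_of_pos {a c s : ℝ} (hs : 0 < s) :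
    betaKernel a c s = ENNReal.ofReal (s ^ c * (1 + s) ^ (-a)) :=
  Set.indicator_of_mem (Set.mem_Ioi.2 hs) _

lemma betaKernel_of_nonpos {a c s : ℝ} (hs : s ≤ 0) : betaKernel a c s = 0 :=
  Set.indicator_of_notMem (Set.notMem_Ioi.2 hs) _

lemma measurable_betaKernel (a c : ℝ) : Measurable (betaKernel a c) :=
  Measurable.indicator (by fun_prop) measurableSet_Ioi

lemma coneBeta_integrand_eq {m : ℕ} [NeZero (m + 1)] (a c : ℝ) (x : Fin (m + 1) → ℝ) :
    (lCone (m + 1)).indicator (fun x => ENNReal.ofReal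
      (lDelta (m + 1) (coneUnit (m + 1) + x) ^ (-a) * lDelta (m + 1) x ^ c)) x
      = betaKernel a c (x 0 - ‖WithLp.toLp 2 (fun j => x (Fin.succ j))‖) *
        betaKernel a c (x 0 + ‖WithLp.toLp 2 (fun j => x (Fin.succ j))‖) := by
  set r := ‖WithLp.toLp 2 (fun j => x (Fin.succ j))‖ with hr
  have hr0 : 0 ≤ r := norm_nonneg _
  have hr2 : r ^ 2 = ∑ j, x (Fin.succ j) ^ 2 := by
    rw [hr, EuclideanSpace.norm_sq_eq]
    simp
  have hD : lDelta (m + 1) x = (x 0 - r) * (x 0 + r) := by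
    rw [lDelta, Fin.sum_univ_succ, ← hr2]
    ring
  have hD1 : lDelta (m + 1) (coneUnit (m + 1) + x) = (1 + (x 0 - r)) * (1 + (x 0 + r)) := by
    rw [lDelta, Fin.sum_univ_succ]
    simp only [Pi.add_apply, coneUnit, Pi.single_eq_same]
    have : ∀ j : Fin m, (Pi.single (0 : Fin (m + 1)) (1 : ℝ) : Fin (m + 1) → ℝ) (Fin.succ j) = 0 :=
      fun j => Pi.single_eq_of_ne (Fin.succ_ne_zero j) _
    simp only [this, zero_add, ← hr2]
    ring
  by_cases hx : 0 < x 0 - r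
  · have hx2 : 0 < x 0 + r := by linarith
    have hmem : x ∈ lCone (m + 1) := ⟨hD ▸ mul_pos hx hx2, by linarith⟩
    rw [Set.indicator_of_mem hmem, betaKernel_of_pos hx, betaKernel_of_pos hx2,
      ← ENNReal.ofReal_mul (by positivity), hD, hD1, Real.mul_rpow hx.le hx2.le,
      Real.mul_rpow (by positivity) (by positivity)]
    congr 1
    ring
  · have hmem : x ∉ lCone (m + 1) := by
      rintro ⟨h1, h2⟩
      rw [hD] at h1
      exact hx (pos_of_mul_pos_left h1 (by linarith))
    rw [Set.indicator_of_notMem hmem, betaKernel_of_nonpos (not_lt.1 hx), zero_mul]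

lemma coneBeta_coneUnit_eq {m : ℕ} [NeZero (m + 1)] (hm : 0 < m) (a c : ℝ) :
    coneBeta (m + 1) a c (coneUnit (m + 1))
      = (volume : Measure (EuclideanSpace ℝ (Fin m))).toSphere Set.univ *
        ∫⁻ u, betaKernel a c u * ∫⁻ r in Set.Ioi (0 : ℝ),
          ENNReal.ofReal (r ^ (m - 1)) * betaKernel a c (u + 2 * r) := by
  have : Nonempty (Fin m) := ⟨⟨0, hm⟩⟩
  have hG := measurable_betaKernel a c
  set F : ℝ × ℝ → ℝ≥0∞ := fun q => betaKernel a c (q.1 - q.2) * betaKernel a c (q.1 + q.2) with hF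
  have hFm : Measurable F := by
    exact (hG.comp (by fun_prop)).mul (hG.comp (by fun_prop))
  have hFn : Measurable fun q : ℝ × (Fin m → ℝ) => F (q.1, ‖WithLp.toLp 2 q.2‖) :=
    hFm.comp (by fun_prop)
  rw [coneBeta, ← lintegral_indicator measurableSet_lCone]
  simp_rw [coneBeta_integrand_eq]
  have h1 := (volume_preserving_piFinSuccAbove (fun _ : Fin (m + 1) => ℝ) 0).lintegral_comp hFn
  have h2 : ∀ t : ℝ, ∫⁻ w : Fin m → ℝ, F (t, ‖WithLp.toLp 2 w‖)
      = (volume : Measure (EuclideanSpace ℝ (Fin m))).toSphere Set.univ *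
        ∫⁻ r in Set.Ioi (0 : ℝ), ENNReal.ofReal (r ^ (m - 1)) * F (t, r) := by
    intro t
    have hFt : Measurable fun r => F (t, r) := hFm.comp (by fun_prop)
    have h3 := (PiLp.volume_preserving_toLp (Fin m)).lintegral_comp
      (f := fun v => F (t, ‖v‖)) (hFt.comp measurable_norm)
    rw [h3, lintegral_fun_norm_addHaar volume hFt]
    simp
  have hK : Measurable fun q : ℝ × ℝ => ENNReal.ofReal (q.2 ^ (m - 1)) * F (q.1, q.2) := by
    exact (Measurable.ennreal_ofReal (by fun_prop)).mul hFm
  calc _ = ∫⁻ q : ℝ × (Fin m → ℝ), F (q.1, ‖WithLp.toLp 2 q.2‖) := by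
        rw [← h1]
        rfl
    _ = ∫⁻ t : ℝ, ∫⁻ w : Fin m → ℝ, F (t, ‖WithLp.toLp 2 w‖) := by
        rw [Measure.volume_eq_prod, lintegral_prod _ hFn.aemeasurable]
    _ = (volume : Measure (EuclideanSpace ℝ (Fin m))).toSphere Set.univ *
        ∫⁻ t : ℝ, ∫⁻ r in Set.Ioi (0 : ℝ), ENNReal.ofReal (r ^ (m - 1)) * F (t, r) := by
        simp_rw [h2]
        rw [lintegral_const_mul]
        exact hK.lintegral_prod_right'
    _ = _ := by
        congr 1
        rw [lintegral_lintegral_swap hK.aemeasurable]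
        have h4 : ∀ r : ℝ, ∫⁻ t : ℝ, ENNReal.ofReal (r ^ (m - 1)) * F (t, r)
            = ∫⁻ u : ℝ, betaKernel a c u *
              (ENNReal.ofReal (r ^ (m - 1)) * betaKernel a c (u + 2 * r)) := by
          intro r
          rw [← lintegral_add_right_eq_self _ r]
          refine lintegral_congr fun u => ?_
          simp only [hF, add_sub_cancel_right]
          rw [show u + r + r = u + 2 * r by ring]
          ring
        simp_rw [h4]
        rw [lintegral_lintegral_swap]
        · refine lintegral_congr fun u => ?_
          rw [lintegral_const_mul]
          exact (Measurable.ennreal_ofReal (by fun_prop)).mul (hG.comp (by fun_prop))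
        · exact ((hG.comp (by fun_prop)).mul ((Measurable.ennreal_ofReal (by fun_prop)).mul
            (hG.comp (by fun_prop)))).aemeasurable

lemma two_mul_lintegral_comp_add_two_mul (u : ℝ) {H : ℝ → ℝ≥0∞} (hH : Measurable H) :
    2 * ∫⁻ r, H (u + 2 * r) = ∫⁻ v, H v := by
  have h := Real.smul_map_volume_mul_left (a := 2) two_ne_zero
  rw [← lintegral_add_left_eq_self H u]
  conv_rhs => rw [← h]
  have hm : Measurable fun v => H (u + v) := hH.comp (by fun_prop)
  rw [lintegral_smul_measure, lintegral_map hm (by fun_prop)]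
  simp

lemma rpow_le_two_rpow_abs {x : ℝ} (b : ℝ) (h1 : 1 ≤ x) (h2 : x ≤ 2) : x ^ b ≤ 2 ^ |b| :=
  (Real.rpow_le_rpow_of_exponent_le h1 (le_abs_self b)).trans
    (Real.rpow_le_rpow (by linarith) h2 (abs_nonneg b))

lemma two_rpow_neg_abs_le_rpow {x : ℝ} (b : ℝ) (h1 : 1 ≤ x) (h2 : x ≤ 2) :
    2 ^ (-|b|) ≤ x ^ b := by
  have h := rpow_le_two_rpow_abs (-b) h1 h2
  rw [abs_neg, Real.rpow_neg (by linarith)] at h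
  rw [Real.rpow_neg zero_le_two]
  exact inv_le_of_inv_le₀ (by positivity) h

lemma rpow_mul_one_add_rpow_eq {s : ℝ} (a c : ℝ) (hs : 0 < s) :
    s ^ c * (1 + s) ^ (-a) = ((1 + s) / s) ^ (-a) * s ^ (c - a) := by
  rw [Real.div_rpow (by positivity) hs.le, sub_eq_add_neg, Real.rpow_add hs]
  have : s ^ (-a) ≠ 0 := (Real.rpow_pos_of_pos hs _).ne'
  field_simp

lemma one_add_div_self_mem {s : ℝ} (hs : 1 ≤ s) : 1 ≤ (1 + s) / s ∧ (1 + s) / s ≤ 2 := by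
  have : 0 < s := by linarith
  constructor
  · rw [le_div_iff₀ this]; linarith
  · rw [div_le_iff₀ this]; linarith

lemma setLIntegral_ofReal_const_mul_rpow_lt_top_iff {S : Set ℝ} (hS : MeasurableSet S)
    (hpos : S ⊆ Set.Ioi 0) {κ : ℝ} (hκ : 0 < κ) (b : ℝ) :
    ∫⁻ x in S, ENNReal.ofReal (κ * x ^ b) < ⊤ ↔ IntegrableOn (fun x : ℝ => x ^ b) S := by
  have hm : Measurable fun x : ℝ => x ^ b := by fun_prop
  have h0 : 0 ≤ᵐ[volume.restrict S] fun x : ℝ => κ * x ^ b := by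
    filter_upwards [ae_restrict_mem hS] with x hx
    exact mul_nonneg hκ.le (Real.rpow_nonneg (le_of_lt (hpos hx)) _)
  rw [← hasFiniteIntegral_iff_ofReal h0, IntegrableOn,
    ← integrable_const_mul_iff (IsUnit.mk0 κ hκ.ne')]
  exact ⟨fun h => ⟨(hm.const_mul κ).aestronglyMeasurable, h⟩, fun h => h.2⟩

lemma setLIntegral_ofReal_const_mul_rpow_ne_zero {S : Set ℝ}
    (hpos : S ⊆ Set.Ioi 0) (hvol : volume S ≠ 0) {κ : ℝ} (hκ : 0 < κ) (b : ℝ) :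
    ∫⁻ x in S, ENNReal.ofReal (κ * x ^ b) ≠ 0 := by
  rw [← pos_iff_ne_zero, setLIntegral_pos_iff (by fun_prop)]
  refine (pos_iff_ne_zero.2 hvol).trans_le (measure_mono fun x hx => ⟨?_, hx⟩)
  rw [Function.mem_support, ← pos_iff_ne_zero, ENNReal.ofReal_pos]
  exact mul_pos hκ (Real.rpow_pos_of_pos (hpos hx) _)

lemma lintegral_betaKernel_lt_top {a c : ℝ} (hc : -1 < c) (hac : c - a < -1) :
    ∫⁻ s, betaKernel a c s < ⊤ := by
  have hκ : (0 : ℝ) < 2 ^ |(-a)| := by positivity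
  have h1 := (setLIntegral_ofReal_const_mul_rpow_lt_top_iff measurableSet_Ioc
    (fun x hx => hx.1) hκ c).2
    (((intervalIntegral.integrableOn_Ioo_rpow_iff one_pos).2 hc).congr_set_ae
      Ioo_ae_eq_Ioc.symm)
  have h2 := (setLIntegral_ofReal_const_mul_rpow_lt_top_iff measurableSet_Ioi
    (Set.Ioi_subset_Ioi zero_le_one) hκ (c - a)).2 ((integrableOn_Ioi_rpow_iff one_pos).2 hac)
  simp only [betaKernel]
  rw [lintegral_indicator measurableSet_Ioi, ← Set.Ioc_union_Ioi_eq_Ioi zero_le_one]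
  refine (lintegral_union_le _ _ _).trans_lt (ENNReal.add_lt_top.2 ⟨?_, ?_⟩)
  · refine lt_of_le_of_lt (setLIntegral_mono' measurableSet_Ioc fun s hs => ?_) h1
    refine ENNReal.ofReal_le_ofReal ?_
    rw [mul_comm]
    have := hs.1
    gcongr
    exact rpow_le_two_rpow_abs _ (by linarith [hs.1]) (by linarith [hs.2])
  · refine lt_of_le_of_lt (setLIntegral_mono' measurableSet_Ioi fun s hs => ?_) h2
    refine ENNReal.ofReal_le_ofReal ?_
    have hs1 : 1 ≤ s := le_of_lt hs
    have hs0 : 0 < s := by linarith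
    rw [rpow_mul_one_add_rpow_eq a c hs0]
    gcongr
    exact rpow_le_two_rpow_abs _ (one_add_div_self_mem hs1).1 (one_add_div_self_mem hs1).2

lemma ofReal_pow_mul_betaKernel (a c : ℝ) (k : ℕ) (v : ℝ) :
    ENNReal.ofReal (v ^ k) * betaKernel a c v = betaKernel a (c + k) v := by
  rcases le_or_gt v 0 with hv | hv
  · rw [betaKernel_of_nonpos hv, betaKernel_of_nonpos hv, mul_zero]
  · rw [betaKernel_of_pos hv, betaKernel_of_pos hv, ← ENNReal.ofReal_mul (by positivity),
      Real.rpow_add hv, Real.rpow_natCast]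
    congr 1
    ring

lemma coneBeta_coneUnit_lt_top {m : ℕ} [NeZero (m + 1)] (hm : 0 < m) {a c : ℝ} (hc : -1 < c)
    (hac : m < a - c) : coneBeta (m + 1) a c (coneUnit (m + 1)) < ⊤ := by
  have hm1 : (1 : ℝ) ≤ m := by exact_mod_cast hm
  have hk : ((m - 1 : ℕ) : ℝ) = m - 1 := by rw [Nat.cast_sub hm, Nat.cast_one]
  rw [coneBeta_coneUnit_eq hm]
  refine ENNReal.mul_lt_top (measure_lt_top _ _) ?_
  have hH := measurable_betaKernel a (c + (m - 1 : ℕ))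
  have hbound : ∀ u, betaKernel a c u * ∫⁻ r in Set.Ioi (0 : ℝ),
      ENNReal.ofReal (r ^ (m - 1)) * betaKernel a c (u + 2 * r)
      ≤ betaKernel a c u * ∫⁻ v, betaKernel a (c + (m - 1 : ℕ)) v := by
    intro u
    rcases le_or_gt u 0 with hu | hu
    · rw [betaKernel_of_nonpos hu, zero_mul, zero_mul]
    · refine mul_le_mul_right ?_ _
      rw [← two_mul_lintegral_comp_add_two_mul u hH]
      calc _ ≤ ∫⁻ r in Set.Ioi (0 : ℝ), betaKernel a (c + (m - 1 : ℕ)) (u + 2 * r) := by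
            refine setLIntegral_mono' measurableSet_Ioi fun r hr => ?_
            have hr0 : 0 < r := hr
            rw [← ofReal_pow_mul_betaKernel]
            gcongr
            linarith
        _ ≤ ∫⁻ r, betaKernel a (c + (m - 1 : ℕ)) (u + 2 * r) := setLIntegral_le_lintegral _ _
        _ ≤ _ := le_mul_of_one_le_left' one_le_two
  refine (lintegral_mono hbound).trans_lt ?_
  rw [lintegral_mul_const _ (measurable_betaKernel a c)]
  refine ENNReal.mul_lt_top (lintegral_betaKernel_lt_top hc (by linarith))
    (lintegral_betaKernel_lt_top ?_ ?_)
  · rw [hk]; linarith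
  · rw [hk]; linarith

lemma of_coneBeta_coneUnit_lt_top {m : ℕ} [NeZero (m + 1)] (hm : 0 < m) {a c : ℝ}
    (h : coneBeta (m + 1) a c (coneUnit (m + 1)) < ⊤) : -1 < c ∧ m < a - c := by
  have : Nonempty (Fin m) := ⟨⟨0, hm⟩⟩
  have hk : ((m - 1 : ℕ) : ℝ) = m - 1 := by rw [Nat.cast_sub hm, Nat.cast_one]
  rw [coneBeta_coneUnit_eq hm] at h
  have hσ : (volume : Measure (EuclideanSpace ℝ (Fin m))).toSphere Set.univ ≠ 0 := by
    rw [Ne, Measure.measure_univ_eq_zero]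
    exact Measure.toSphere_ne_zero _
  have hfin := ENNReal.lt_top_of_mul_ne_top_right h.ne hσ
  have hκ : (0 : ℝ) < 2 ^ (-|(-a)|) := by positivity
  have hκ' : (0 : ℝ) < (1 / 4) ^ (m - 1) * 2 ^ (-|(-a)|) := by positivity
  set e : ℝ := (m - 1 : ℕ) + (c - a) with he
  set A := ∫⁻ s in Set.Ioo (0 : ℝ) 1, ENNReal.ofReal (2 ^ (-|(-a)|) * s ^ c) with hA
  set H : ℝ → ℝ≥0∞ := (Set.Ioi (2 : ℝ)).indicator
    fun v => ENNReal.ofReal ((1 / 4) ^ (m - 1) * 2 ^ (-|(-a)|) * v ^ e) with hH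
  have hHm : Measurable H := Measurable.indicator (by fun_prop) measurableSet_Ioi
  have hB : ∫⁻ v, H v = ∫⁻ v in Set.Ioi (2 : ℝ),
      ENNReal.ofReal ((1 / 4) ^ (m - 1) * 2 ^ (-|(-a)|) * v ^ e) :=
    lintegral_indicator measurableSet_Ioi _
  have hinner : ∀ u ∈ Set.Ioo (0 : ℝ) 1, ∫⁻ v, H v ≤ 2 * ∫⁻ r in Set.Ioi (0 : ℝ),
      ENNReal.ofReal (r ^ (m - 1)) * betaKernel a c (u + 2 * r) := by
    intro u hu
    rw [← two_mul_lintegral_comp_add_two_mul u hHm, ← lintegral_indicator measurableSet_Ioi]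
    gcongr with r
    by_cases hr : 2 < u + 2 * r
    · have hr0 : 0 < r := by linarith [hu.2]
      have hv0 : 0 < u + 2 * r := by linarith
      rw [hH, Set.indicator_of_mem (Set.mem_Ioi.2 hr), Set.indicator_of_mem (Set.mem_Ioi.2 hr0),
        betaKernel_of_pos hv0, ← ENNReal.ofReal_mul (by positivity)]
      refine ENNReal.ofReal_le_ofReal ?_
      have hq := one_add_div_self_mem (s := u + 2 * r) (by linarith)
      rw [rpow_mul_one_add_rpow_eq a c hv0, he, Real.rpow_add hv0, Real.rpow_natCast]
      calc _ = ((u + 2 * r) / 4) ^ (m - 1) * (2 ^ (-|(-a)|) * (u + 2 * r) ^ (c - a)) := by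
            rw [div_pow, div_pow, one_pow]
            ring
        _ ≤ _ := by
            gcongr
            · linarith [hu.2]
            · exact two_rpow_neg_abs_le_rpow _ hq.1 hq.2
    · rw [hH, Set.indicator_of_notMem (by simpa using hr)]
      exact zero_le
  have hAB : A * ∫⁻ v, H v ≤ 2 * ∫⁻ u, betaKernel a c u * ∫⁻ r in Set.Ioi (0 : ℝ),
      ENNReal.ofReal (r ^ (m - 1)) * betaKernel a c (u + 2 * r) := by
    rw [hA, ← lintegral_mul_const _ (by fun_prop), ← lintegral_const_mul' _ _ (by simp)]
    refine (setLIntegral_mono' measurableSet_Ioo fun u hu => ?_).trans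
      (setLIntegral_le_lintegral _ _)
    rw [mul_left_comm, betaKernel_of_pos hu.1, mul_comm (u ^ c)]
    have hu0 := hu.1
    gcongr
    · exact two_rpow_neg_abs_le_rpow _ (by linarith) (by linarith [hu.2])
    · exact hinner u hu
  have hAB' : A * ∫⁻ v, H v < ⊤ := hAB.trans_lt (ENNReal.mul_lt_top (by simp) hfin)
  have hsub : Set.Ioi (2 : ℝ) ⊆ Set.Ioi 0 := Set.Ioi_subset_Ioi zero_le_two
  have hA0 : A ≠ 0 := setLIntegral_ofReal_const_mul_rpow_ne_zero
    (fun x hx => hx.1) (by simp) hκ c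
  have hB0 : ∫⁻ v, H v ≠ 0 := hB ▸ setLIntegral_ofReal_const_mul_rpow_ne_zero
    hsub (by simp) hκ' e
  have hAt := ENNReal.lt_top_of_mul_ne_top_left hAB'.ne hB0
  have hBt := ENNReal.lt_top_of_mul_ne_top_right hAB'.ne hA0
  rw [hB, setLIntegral_ofReal_const_mul_rpow_lt_top_iff measurableSet_Ioi hsub hκ',
    integrableOn_Ioi_rpow_iff two_pos] at hBt
  rw [hA, setLIntegral_ofReal_const_mul_rpow_lt_top_iff measurableSet_Ioo (fun x hx => hx.1) hκ,
    intervalIntegral.integrableOn_Ioo_rpow_iff one_pos] at hAt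
  refine ⟨hAt, ?_⟩
  rw [he, hk] at hBt
  linarith

lemma coneBeta_coneUnit_lt_top_iff {n : ℕ} [NeZero n] (hn : 2 ≤ n) (a c : ℝ) :
    coneBeta n a c (coneUnit n) < ⊤ ↔ -1 < c ∧ (n : ℝ) - 1 < a - c := by
  obtain ⟨m, rfl⟩ : ∃ m, n = m + 1 := ⟨n - 1, by omega⟩
  rw [Nat.cast_add, Nat.cast_one, add_sub_cancel_right]
  exact ⟨of_coneBeta_coneUnit_lt_top (by omega),
    fun h => coneBeta_coneUnit_lt_top (by omega) h.1 h.2⟩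

section Duality

variable {n : ℕ} [NeZero n]

lemma ofReal_kernel_eq {β γ p q ν : ℝ} (hpq : p.HolderConjugate q) {x y : Fin n → ℝ}
    (hy : y ∈ lCone n) (hx : x ∈ lCone n) :
    ENNReal.ofReal (lDelta n (y + x) ^ (-γ) * lDelta n x ^ (β - (ν - (n : ℝ) / 2) / p)) ^ q
      = ENNReal.ofReal (lDelta n (y + x) ^ (-(q * γ)) *
        lDelta n x ^ (q * (β - (ν - (n : ℝ) / 2) / p))) := by
  have hyx := (add_mem_lCone hy hx).1
  have hx1 := hx.1
  rw [ENNReal.ofReal_rpow_of_nonneg (by positivity) hpq.symm.nonneg,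
    Real.mul_rpow (by positivity) (by positivity), ← Real.rpow_mul hyx.le, ← Real.rpow_mul hx1.le]
  congr 3 <;> ring

lemma Sop_le {α β γ p q ν : ℝ} (hpq : p.HolderConjugate q) {g : (Fin n → ℝ) → ℝ}
    (hg : Measurable g) {y : Fin n → ℝ} (hy : y ∈ lCone n) :
    Sop n α β γ g y ≤ ENNReal.ofReal (lDelta n y ^ α) *
      coneBeta n (q * γ) (q * (β - (ν - (n : ℝ) / 2) / p)) y ^ (1 / q) * coneNorm n p ν g := by
  have hΔ := measurable_lDelta (n := n)
  rw [Sop, mul_assoc]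
  gcongr
  have h := ENNReal.lintegral_mul_le_Lp_mul_Lq (volume.restrict (lCone n)) hpq.symm
    (f := fun x => ENNReal.ofReal
      (lDelta n (y + x) ^ (-γ) * lDelta n x ^ (β - (ν - (n : ℝ) / 2) / p)))
    (g := fun x => ENNReal.ofReal (|g x| * lDelta n x ^ ((ν - (n : ℝ) / 2) / p)))
    (by fun_prop) (by fun_prop)
  refine (le_of_eq ?_).trans (h.trans (le_of_eq ?_))
  · refine setLIntegral_congr_fun measurableSet_lCone fun x hx => ?_
    have hx1 := hx.1
    have hyx := (add_mem_lCone hy hx).1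
    simp only [Pi.mul_apply]
    rw [← ENNReal.ofReal_mul (by positivity), Real.rpow_sub hx1]
    congr 1
    have : lDelta n x ^ ((ν - (n : ℝ) / 2) / p) ≠ 0 := (Real.rpow_pos_of_pos hx1 _).ne'
    field_simp
  · rw [coneBeta, coneNorm]
    congr 2
    · exact setLIntegral_congr_fun measurableSet_lCone fun x hx => ofReal_kernel_eq hpq hy hx
    · refine setLIntegral_congr_fun measurableSet_lCone fun x hx => ?_
      have hx1 := hx.1
      rw [ENNReal.ofReal_rpow_of_nonneg (by positivity) hpq.nonneg,
        Real.mul_rpow (by positivity) (by positivity), ← Real.rpow_mul hx1.le,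
        div_mul_cancel₀ _ hpq.ne_zero]

lemma rpow_one_div_le_of_mul_le {p q : ℝ} (hpq : p.HolderConjugate q) {A I C : ℝ≥0∞}
    (hI : I ≠ ⊤) (h : A * I ≤ C * I ^ (1 / p)) : A * I ^ (1 / q) ≤ C := by
  rcases eq_or_ne I 0 with rfl | hI0
  · rw [ENNReal.zero_rpow_of_pos (one_div_pos.2 hpq.symm.pos), mul_zero]
    exact zero_le
  · have hsplit : I = I ^ (1 / q) * I ^ (1 / p) := by
      rw [← ENNReal.rpow_add _ _ hI0 hI, one_div, one_div, add_comm, hpq.inv_add_inv_eq_one,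
        ENNReal.rpow_one]
    have h0 : I ^ (1 / p) ≠ 0 := by simp [hI0, hI]
    have ht : I ^ (1 / p) ≠ ⊤ := ENNReal.rpow_ne_top_of_nonneg (one_div_nonneg.2 hpq.nonneg) hI
    rw [hsplit, ← mul_assoc] at h
    rw [← hsplit] at h
    exact (ENNReal.mul_le_mul_iff_left h0 ht).1 h

lemma mul_coneBeta_le {α β γ p q ν : ℝ} (hpq : p.HolderConjugate q) {C : ℝ≥0∞}
    {y : Fin n → ℝ} (hy : y ∈ lCone n)
    (h : ∀ g : (Fin n → ℝ) → ℝ, Measurable g → coneNorm n p ν g < ⊤ →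
      Sop n α β γ g y ≤ C * coneNorm n p ν g) :
    ENNReal.ofReal (lDelta n y ^ α) *
      coneBeta n (q * γ) (q * (β - (ν - (n : ℝ) / 2) / p)) y ^ (1 / q) ≤ C := by
  have hΔ := measurable_lDelta (n := n)
  set δ := (ν - (n : ℝ) / 2) / p with hδ
  set k : (Fin n → ℝ) → ℝ := fun x => lDelta n (y + x) ^ (-γ) * lDelta n x ^ (β - δ) with hk
  have hkm : Measurable k := by fun_prop
  have hkpos : ∀ x ∈ lCone n, 0 < k x := fun x hx =>
    mul_pos (Real.rpow_pos_of_pos (add_mem_lCone hy hx).1 _) (Real.rpow_pos_of_pos hx.1 _)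
  set μ := (volume.restrict (lCone n)).withDensity fun x => ENNReal.ofReal (k x ^ q) with hμ
  have hbeta : coneBeta n (q * γ) (q * (β - δ)) y = μ Set.univ := by
    rw [hμ, withDensity_apply _ MeasurableSet.univ, Measure.restrict_univ, coneBeta]
    refine setLIntegral_congr_fun measurableSet_lCone fun x hx => ?_
    rw [← ofReal_kernel_eq hpq hy hx, ENNReal.ofReal_rpow_of_nonneg (hkpos x hx).le
      hpq.symm.nonneg]
  have hbound : ∀ s, MeasurableSet s → μ s < ⊤ →
      ENNReal.ofReal (lDelta n y ^ α) * μ s ^ (1 / q) ≤ C := by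
    intro s hs hfin
    have hμs : μ s = ∫⁻ x in lCone n, s.indicator (fun x => ENNReal.ofReal (k x ^ q)) x := by
      rw [hμ, withDensity_apply _ hs, lintegral_indicator hs]
    set g : (Fin n → ℝ) → ℝ := s.indicator fun x => k x ^ (q - 1) * lDelta n x ^ (-δ) with hg
    have hgm : Measurable g := Measurable.indicator (by fun_prop) hs
    have hnorm : coneNorm n p ν g = μ s ^ (1 / p) := by
      rw [coneNorm, hμs]
      congr 1
      refine setLIntegral_congr_fun measurableSet_lCone fun x hx => ?_
      simp only [hg]
      by_cases hxs : x ∈ s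
      · have hx1 := hx.1
        have hk0 := hkpos x hx
        rw [Set.indicator_of_mem hxs, Set.indicator_of_mem hxs, abs_of_nonneg (by positivity),
          Real.mul_rpow (by positivity) (by positivity), ← Real.rpow_mul hk0.le,
          ← Real.rpow_mul hx1.le, mul_assoc, ← Real.rpow_add hx1]
        have e1 : (q - 1) * p = q := by
          have := hpq.symm.sub_one_mul_conj
          linarith
        have e2 : -δ * p + (ν - (n : ℝ) / 2) = 0 := by
          rw [hδ, neg_mul, div_mul_cancel₀ _ hpq.ne_zero, neg_add_cancel]
        rw [e1, e2, Real.rpow_zero, mul_one]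
      · rw [Set.indicator_of_notMem hxs, Set.indicator_of_notMem hxs, abs_zero,
          Real.zero_rpow hpq.ne_zero, zero_mul, ENNReal.ofReal_zero]
    have hop : Sop n α β γ g y = ENNReal.ofReal (lDelta n y ^ α) * μ s := by
      rw [Sop, hμs]
      congr 1
      refine setLIntegral_congr_fun measurableSet_lCone fun x hx => ?_
      simp only [hg]
      by_cases hxs : x ∈ s
      · have hx1 := hx.1
        have hk0 := hkpos x hx
        rw [Set.indicator_of_mem hxs, Set.indicator_of_mem hxs, abs_of_nonneg (by positivity)]
        have e1 : k x ^ q = k x ^ (q - 1) * k x := by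
          rw [Real.rpow_sub_one hk0.ne', div_mul_cancel₀ _ hk0.ne']
        have e2 : lDelta n x ^ (β - δ) = lDelta n x ^ β * lDelta n x ^ (-δ) := by
          rw [← Real.rpow_add hx1, sub_eq_add_neg]
        have e3 : k x = lDelta n (y + x) ^ (-γ) * (lDelta n x ^ β * lDelta n x ^ (-δ)) := by
          rw [← e2]
        rw [e1]
        nth_rewrite 3 [e3]
        congr 1
        ring
      · rw [Set.indicator_of_notMem hxs, Set.indicator_of_notMem hxs]
        simp
    refine rpow_one_div_le_of_mul_le hpq hfin.ne ?_
    rw [← hop, ← hnorm]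
    refine h g hgm ?_
    rw [hnorm]
    exact ENNReal.rpow_lt_top_of_nonneg (one_div_nonneg.2 hpq.nonneg) hfin.ne
  rw [hbeta]
  have hlim : Filter.Tendsto (fun i => μ (spanningSets μ i)) Filter.atTop
      (nhds (μ Set.univ)) := by
    rw [← iUnion_spanningSets μ]
    exact tendsto_measure_iUnion_atTop (monotone_spanningSets μ)
  have hlim2 := ENNReal.Tendsto.const_mul (a := ENNReal.ofReal (lDelta n y ^ α))
    (((ENNReal.continuous_rpow_const (y := 1 / q)).tendsto _).comp hlim)
    (Or.inr ENNReal.ofReal_ne_top)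
  exact le_of_tendsto' hlim2 fun i =>
    hbound _ (measurableSet_spanningSets μ i) (measure_spanningSets_lt_top μ i)

lemma coneBeta_coneUnit_ne_zero (a c : ℝ) : coneBeta n a c (coneUnit n) ≠ 0 := by
  rw [coneBeta, ← pos_iff_ne_zero,
    setLIntegral_pos_iff (measurable_coneBeta_integrand a c _).ennreal_ofReal]
  refine (isOpen_lCone.measure_pos volume ⟨_, coneUnit_mem⟩).trans_le
    (measure_mono fun x hx => ⟨?_, hx⟩)
  rw [Function.mem_support, ← pos_iff_ne_zero, ENNReal.ofReal_pos]
  exact mul_pos (Real.rpow_pos_of_pos (add_mem_lCone coneUnit_mem hx).1 _)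
    (Real.rpow_pos_of_pos hx.1 _)

lemma mul_coneBeta_rpow_eq {α β γ p q ν : ℝ} (hpq : p.HolderConjugate q) {y : Fin n → ℝ}
    (hy : y ∈ lCone n) :
    ENNReal.ofReal (lDelta n y ^ α) *
        coneBeta n (q * γ) (q * (β - (ν - (n : ℝ) / 2) / p)) y ^ (1 / q)
      = ENNReal.ofReal (lDelta n y ^ (α + β + (n : ℝ) / 2 - ν / p - γ)) *
        coneBeta n (q * γ) (q * (β - (ν - (n : ℝ) / 2) / p)) (coneUnit n) ^ (1 / q) := by
  have hy1 := hy.1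
  have hp0 := hpq.ne_zero
  have hq0 := hpq.symm.ne_zero
  rw [coneBeta_eq _ _ hy, ENNReal.mul_rpow_of_nonneg _ _ (one_div_nonneg.2 hpq.symm.nonneg),
    ← mul_assoc, ENNReal.ofReal_rpow_of_nonneg (by positivity) (one_div_nonneg.2 hpq.symm.nonneg),
    ← ENNReal.ofReal_mul (by positivity), ← Real.rpow_mul hy1.le, ← Real.rpow_add hy1]
  have hinv : 1 / q = 1 - 1 / p := by
    have := hpq.inv_add_inv_eq_one
    rw [one_div, one_div]
    linarith
  congr 3
  have e : (n : ℝ) / 2 * (1 / q) = (n : ℝ) / 2 - (n : ℝ) / 2 / p := by rw [hinv]; ring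
  have e2 : ((n : ℝ) / 2 - q * γ + q * (β - (ν - (n : ℝ) / 2) / p)) * (1 / q)
      = (n : ℝ) / 2 * (1 / q) - γ + (β - (ν - (n : ℝ) / 2) / p) := by
    field_simp
  rw [e2, e]
  ring

lemma eq_zero_of_forall_ofReal_rpow_mul_le {s : ℝ} {b C : ℝ≥0∞} (hb : b ≠ 0) (hC : C ≠ ⊤)
    (h : ∀ y ∈ lCone n, ENNReal.ofReal (lDelta n y ^ s) * b ≤ C) : s = 0 := by
  by_contra hs
  have hlarge : ∀ M : ℝ, 0 < M → ENNReal.ofReal M * b ≤ C := by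
    intro M hM
    set t := M ^ (1 / (2 * s)) with ht
    have ht0 : 0 < t := by positivity
    have hΔ : lDelta n (t • coneUnit n) = t ^ 2 := by
      have : lDelta n (t • coneUnit n) = t ^ 2 * lDelta n (coneUnit n) := by
        simp only [lDelta, Pi.smul_apply, smul_eq_mul, mul_pow, ← Finset.mul_sum]
        ring
      rw [this, lDelta_coneUnit, mul_one]
    have hmem : t • coneUnit n ∈ lCone n :=
      ⟨by rw [hΔ]; positivity, by simpa [coneUnit] using ht0⟩
    have h1 := h _ hmem
    rw [hΔ, ht, ← Real.rpow_natCast, ← Real.rpow_mul hM.le, ← Real.rpow_mul hM.le] at h1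
    have e : 1 / (2 * s) * (2 : ℕ) * s = 1 := by
      push_cast
      field_simp
    rwa [e, Real.rpow_one] at h1
  have hbt : b ≠ ⊤ := by
    rintro rfl
    have := hlarge 1 one_pos
    rw [ENNReal.ofReal_one, one_mul, top_le_iff] at this
    exact hC this
  have hb0 : 0 < b.toReal := ENNReal.toReal_pos hb hbt
  have hlast := hlarge ((C.toReal + 1) / b.toReal) (by positivity)
  rw [← ENNReal.ofReal_toReal hbt, ← ENNReal.ofReal_mul (by positivity),
    ENNReal.toReal_ofReal hb0.le, div_mul_cancel₀ _ hb0.ne', 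
    ENNReal.ofReal_le_iff_le_toReal hC] at hlast
  linarith

/-- Boundedness into `L^∞` amounts to homogeneity together with the convergence of the beta
integral. -/
lemma SBoundedSup_iff_coneBeta {α β γ p q ν : ℝ} (hpq : p.HolderConjugate q) :
    SBoundedSup n α β γ p ν ↔ γ = α + β + (n : ℝ) / 2 - ν / p ∧
      coneBeta n (q * γ) (q * (β - (ν - (n : ℝ) / 2) / p)) (coneUnit n) < ⊤ := by
  have hq0 : 0 < 1 / q := one_div_pos.2 hpq.symm.pos
  constructor
  · rintro ⟨C, hC, h⟩
    have hle : ∀ y ∈ lCone n, ENNReal.ofReal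
        (lDelta n y ^ (α + β + (n : ℝ) / 2 - ν / p - γ)) *
        coneBeta n (q * γ) (q * (β - (ν - (n : ℝ) / 2) / p)) (coneUnit n) ^ (1 / q)
        ≤ ENNReal.ofReal C := fun y hy => mul_coneBeta_rpow_eq (α := α) (β := β) (γ := γ) (ν := ν) hpq hy ▸
      mul_coneBeta_le hpq hy fun g hg hgn => h g hg hgn y hy
    have hfin : coneBeta n (q * γ) (q * (β - (ν - (n : ℝ) / 2) / p)) (coneUnit n) < ⊤ := by
      have h1 := hle _ coneUnit_mem
      rw [lDelta_coneUnit, Real.one_rpow, ENNReal.ofReal_one, one_mul] at h1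
      exact (ENNReal.rpow_lt_top_iff_of_pos hq0).1 (h1.trans_lt ENNReal.ofReal_lt_top)
    refine ⟨?_, hfin⟩
    have := eq_zero_of_forall_ofReal_rpow_mul_le
      (by simp [coneBeta_coneUnit_ne_zero, hfin.ne]) ENNReal.ofReal_ne_top hle
    linarith
  · rintro ⟨hγ, hfin⟩
    have hs : α + β + (n : ℝ) / 2 - ν / p - γ = 0 := by linarith
    have hb := (ENNReal.rpow_lt_top_iff_of_pos hq0).2 hfin
    refine ⟨_, ENNReal.toReal_pos (by simp [coneBeta_coneUnit_ne_zero, hfin.ne]) hb.ne,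
      fun g hg _ y hy => (Sop_le (ν := ν) hpq hg hy).trans_eq ?_⟩
    rw [mul_coneBeta_rpow_eq hpq hy, hs, Real.rpow_zero, ENNReal.ofReal_one, one_mul,
      ENNReal.ofReal_toReal hb.ne]

end Duality

/-- Theorem 2.3 of the paper on the rank-2 Lorentz cone (second limit case, target `L^∞`). -/
theorem statement2 (n : ℕ) [NeZero n] (hn : 3 ≤ n) (α β γ ν p : ℝ)
    (hp : 1 < p) :
    SBoundedSup n α β γ p ν ↔
      (γ = α + β + (n : ℝ) / 2 - ν / p ∧
        ν < p * (β + 1) + (n : ℝ) / 2 - 1 ∧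
        p * (α - (n : ℝ) / 2 + 1) > -((n : ℝ) / 2) + 1) := by
  have hpq : p.HolderConjugate (p / (p - 1)) := Real.HolderConjugate.conjExponent hp
  have hp1 : 0 < p - 1 := by linarith
  have hp0 : 0 < p := by linarith
  rw [SBoundedSup_iff_coneBeta hpq, coneBeta_coneUnit_lt_top_iff (by omega)]
  refine and_congr_right fun hγ => and_congr ?_ ?_
  · have e : p / (p - 1) * (β - (ν - (n : ℝ) / 2) / p)
        = (p * β - ν + (n : ℝ) / 2) / (p - 1) := by
      field_simp
      ring
    rw [e, lt_div_iff₀ hp1]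
    constructor <;> intro h <;> linarith
  · have e : p / (p - 1) * γ - p / (p - 1) * (β - (ν - (n : ℝ) / 2) / p)
        = (p * α + (p - 1) * ((n : ℝ) / 2)) / (p - 1) := by
      rw [hγ]
      field_simp
      ring
    rw [e, lt_div_iff₀ hp1, gt_iff_lt]
    constructor <;> intro h <;> linarith
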